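/- (Directionally-dependent quadratic lower bound.) There exists a constant $\gamma^* > 0$ such that for every $\theta = (\theta_1,\theta_2,\theta_3) \in [-\pi,\pi)^3$ and every continuously differentiable $\mathbb{Z}^3$-periodic $u : \mathbb{R}^3 \to \mathbb{C}$, one has $a_\theta[u] \ge \gamma^* \Big( |\theta_3|^2 \int_{\square\cap F} |u|^2\,\mathrm{d}y + |\theta|^2 \int_{\square\setminus F} |u|^2\,\mathrm{d}y \Big)$. -/

import Mathlib

open MeasureTheory
open scoped Classical

/-- The partial derivative `∂_j f` of a function `f : ℝ³ → ℂ`. -/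
noncomputable def pd3 (f : (Fin 3 → ℝ) → ℂ) (j : Fin 3) (x : Fin 3 → ℝ) : ℂ :=
  fderiv ℝ f x (Pi.single j 1)

/-- The dual cell `□* = [-π,π)³`. -/
noncomputable def dualCell : Set (Fin 3 → ℝ) :=
  Set.univ.pi fun _ => Set.Ico (-Real.pi) Real.pi

/-- The periodic reference cell `□ = [-1/2,1/2)³`. -/
noncomputable def cell : Set (Fin 3 → ℝ) :=
  Set.univ.pi fun _ => Set.Ico (-(1 : ℝ) / 2) (1 / 2)

/-- The periodically extended fibre set `⋃_{m' ∈ ℤ²} (B + m') × ℝ`, where `B` is the open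
disk of radius `r` centred at the origin. -/
def fiberSet (r : ℝ) : Set (Fin 3 → ℝ) :=
  {y | ∃ m : Fin 2 → ℤ, (y 0 - (m 0 : ℝ)) ^ 2 + (y 1 - (m 1 : ℝ)) ^ 2 < r ^ 2}

/-- The quadratic form `a_θ[u] = ∫_{□∖F} |∇u + iθu|² dy + ∫_{□∩F} a(y₃)|∂₃u + iθ₃u|² dy`. -/
noncomputable def aForm (a : ℝ → ℝ) (r : ℝ) (θ : Fin 3 → ℝ) (u : (Fin 3 → ℝ) → ℂ) : ℝ :=
  ∫ y in cell,
    if y ∈ fiberSet r then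
      a (y 2) * ‖pd3 u 2 y + Complex.I * (θ 2 : ℂ) * u y‖ ^ 2
    else
      ∑ j, ‖pd3 u j y + Complex.I * (θ j : ℂ) * u y‖ ^ 2

open Function Real

/-! ### One-dimensional estimates -/

lemma two_div_pi_mul_abs_le_norm_exp_sub_one {x : ℝ} (hx : |x| ≤ π) :
    2 / π * |x| ≤ ‖Complex.exp (Complex.I * x) - 1‖ := by
  rw [Complex.norm_exp_I_mul_ofReal_sub_one]
  have h := mul_abs_le_abs_sin (x := x / 2) (by rw [abs_div, abs_two]; linarith)
  rw [abs_div, abs_two] at h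
  rw [norm_mul, Real.norm_eq_abs, Real.norm_eq_abs, abs_two]
  linarith

lemma sq_intervalIntegral_le {h : ℝ → ℝ} (hh : Continuous h) {a b : ℝ} (hab : a ≤ b)
    (hab' : b ≤ a + 1) : (∫ t in a..b, h t) ^ 2 ≤ ∫ t in a..b, h t ^ 2 := by
  set M := ∫ t in a..b, h t with hM
  have h0 : 0 ≤ ∫ t in a..b, (h t - M) ^ 2 :=
    intervalIntegral.integral_nonneg hab fun t _ => sq_nonneg _
  have h1 : ∫ t in a..b, (h t - M) ^ 2
      = (∫ t in a..b, h t ^ 2) - 2 * M * M + (b - a) * M ^ 2 := by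
    have : ∀ t, (h t - M) ^ 2 = h t ^ 2 - 2 * M * h t + M ^ 2 := fun t => by ring
    simp_rw [this]
    rw [intervalIntegral.integral_add, intervalIntegral.integral_sub,
      intervalIntegral.integral_const_mul, intervalIntegral.integral_const, smul_eq_mul]
    all_goals exact Continuous.intervalIntegrable (by fun_prop) _ _
  nlinarith [sq_nonneg M]

lemma norm_sub_sq_le_intervalIntegral {f f' : ℝ → ℂ} (hf : ∀ t, HasDerivAt f (f' t) t)
    (hf' : Continuous f') {a b : ℝ} (hab : a ≤ b) (hab' : b ≤ a + 1) :
    ‖f b - f a‖ ^ 2 ≤ ∫ t in a..b, ‖f' t‖ ^ 2 := by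
  rw [← intervalIntegral.integral_eq_sub_of_hasDerivAt (fun t _ => hf t)
    (hf'.intervalIntegrable _ _)]
  calc _ ≤ (∫ t in a..b, ‖f' t‖) ^ 2 := by
        gcongr
        exact intervalIntegral.norm_integral_le_integral_norm hab
    _ ≤ _ := sq_intervalIntegral_le hf'.norm hab hab'

/-! ### Averaging over one coordinate -/

lemma lintegral_pi_lintegral_update {ι : Type*} [Fintype ι] [DecidableEq ι] {X : ι → Type*}
    [∀ i, MeasurableSpace (X i)] (μ : ∀ i, Measure (X i)) [∀ i, IsProbabilityMeasure (μ i)]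
    (j : ι) {f : (∀ i, X i) → ENNReal} (hf : Measurable f) :
    ∫⁻ y, ∫⁻ t, f (update y j t) ∂μ j ∂Measure.pi μ = ∫⁻ y, f y ∂Measure.pi μ := by
  have : Nonempty (∀ i, X i) := ⟨fun i => (nonempty_of_isProbabilityMeasure (μ i)).some⟩
  obtain ⟨x⟩ := this
  have hPf : Measurable fun y => ∫⁻ t, f (update y j t) ∂μ j :=
    (hf.comp measurable_update').lintegral_prod_right'
  rw [lintegral_eq_lmarginal_univ x, lintegral_eq_lmarginal_univ x,
    lmarginal_erase' _ hf (Finset.mem_univ j), lmarginal_erase' _ hPf (Finset.mem_univ j)]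
  simp

/-- Lebesgue measure on the unit interval `[-1/2,1/2)`. -/
noncomputable def unitMeasure : Measure ℝ := volume.restrict (Set.Ico (-(1 : ℝ) / 2) (1 / 2))

instance : IsProbabilityMeasure unitMeasure :=
  ⟨by rw [unitMeasure, Measure.restrict_apply_univ, Real.volume_Ico]; norm_num⟩

lemma volume_restrict_cell : volume.restrict cell = Measure.pi fun _ : Fin 3 => unitMeasure := by
  rw [cell, volume_pi, Measure.restrict_pi_pi]; rfl

lemma lintegral_cell_lintegral_update (j : Fin 3) {f : (Fin 3 → ℝ) → ENNReal}
    (hf : Measurable f) :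
    ∫⁻ y in cell, ∫⁻ t, f (update y j t) ∂unitMeasure = ∫⁻ y in cell, f y := by
  rw [volume_restrict_cell]
  exact lintegral_pi_lintegral_update (fun _ => unitMeasure) j hf

lemma measurableSet_cell : MeasurableSet cell :=
  MeasurableSet.univ_pi fun _ => measurableSet_Ico

/-! ### The shifted gradient -/

/-- The component `∂_j u + iθ_j u` of the shifted gradient. -/
noncomputable def shiftedGrad (θ : Fin 3 → ℝ) (u : (Fin 3 → ℝ) → ℂ) (j : Fin 3)
    (y : Fin 3 → ℝ) : ℂ :=
  pd3 u j y + Complex.I * (θ j : ℂ) * u y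

lemma continuous_shiftedGrad {u : (Fin 3 → ℝ) → ℂ} (hu : ContDiff ℝ 1 u) (θ : Fin 3 → ℝ)
    (j : Fin 3) : Continuous (shiftedGrad θ u j) := by
  have h1 : Continuous (pd3 u j) := (hu.continuous_fderiv one_ne_zero).clm_apply continuous_const
  have h2 := hu.continuous
  unfold shiftedGrad
  fun_prop

lemma hasDerivAt_exp_mul_update {u : (Fin 3 → ℝ) → ℂ} (hu : ContDiff ℝ 1 u) (θ : Fin 3 → ℝ)
    (y : Fin 3 → ℝ) (j : Fin 3) (t : ℝ) :
    HasDerivAt (fun t : ℝ => Complex.exp (Complex.I * ((θ j * t : ℝ) : ℂ)) * u (update y j t))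
      (Complex.exp (Complex.I * ((θ j * t : ℝ) : ℂ)) * shiftedGrad θ u j (update y j t)) t := by
  have h1 : HasDerivAt (fun t : ℝ => u (update y j t)) (pd3 u j (update y j t)) t :=
    ((hu.differentiable one_ne_zero) _).hasFDerivAt.comp_hasDerivAt t (hasDerivAt_update y j t)
  have h2 : HasDerivAt (fun t : ℝ => Complex.I * ((θ j * t : ℝ) : ℂ))
      (Complex.I * ((θ j * 1 : ℝ) : ℂ)) t :=
    (((hasDerivAt_id t).const_mul (θ j)).ofReal_comp).const_mul Complex.I
  refine (h2.cexp.mul h1).congr_deriv ?_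
  unfold shiftedGrad
  push_cast
  ring

lemma norm_exp_mul_sub_sq_le {u : (Fin 3 → ℝ) → ℂ} (hu : ContDiff ℝ 1 u) (θ : Fin 3 → ℝ)
    (y : Fin 3 → ℝ) (j : Fin 3) {a b : ℝ} (hab : a ≤ b) (hab' : b ≤ a + 1) :
    ‖Complex.exp (Complex.I * ((θ j * b : ℝ) : ℂ)) * u (update y j b)
      - Complex.exp (Complex.I * ((θ j * a : ℝ) : ℂ)) * u (update y j a)‖ ^ 2
      ≤ ∫ t in a..b, ‖shiftedGrad θ u j (update y j t)‖ ^ 2 := by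
  have hc := continuous_shiftedGrad hu θ j
  have h := norm_sub_sq_le_intervalIntegral (hasDerivAt_exp_mul_update hu θ y j)
    (by fun_prop) hab hab'
  simpa only [norm_mul, Complex.norm_exp_I_mul_ofReal, one_mul] using h

/-- The energy density `|∂_j u + iθ_j u|²`. -/
noncomputable def energyDensity (θ : Fin 3 → ℝ) (u : (Fin 3 → ℝ) → ℂ) (j : Fin 3)
    (y : Fin 3 → ℝ) : ENNReal :=
  ENNReal.ofReal (‖shiftedGrad θ u j y‖ ^ 2)

lemma measurable_energyDensity {u : (Fin 3 → ℝ) → ℂ} (hu : ContDiff ℝ 1 u) (θ : Fin 3 → ℝ)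
    (j : Fin 3) : Measurable (energyDensity θ u j) :=
  ENNReal.measurable_ofReal.comp ((continuous_shiftedGrad hu θ j).norm.pow 2).measurable

lemma ofReal_intervalIntegral_shiftedGrad {u : (Fin 3 → ℝ) → ℂ} (hu : ContDiff ℝ 1 u)
    (θ : Fin 3 → ℝ) (y : Fin 3 → ℝ) (j : Fin 3) {a b : ℝ} (hab : a ≤ b) :
    ENNReal.ofReal (∫ t in a..b, ‖shiftedGrad θ u j (update y j t)‖ ^ 2)
      = ∫⁻ t in Set.Ico a b, energyDensity θ u j (update y j t) := by
  have hc := continuous_shiftedGrad hu θ j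
  have hc' : Continuous fun t => ‖shiftedGrad θ u j (update y j t)‖ ^ 2 := by fun_prop
  rw [intervalIntegral.integral_of_le hab, ← integral_Ico_eq_integral_Ioc,
    ofReal_integral_eq_lintegral_ofReal]
  · rfl
  · exact (hc'.integrableOn_Icc (a := a) (b := b)).mono_set Set.Ico_subset_Icc_self
  · exact ae_of_all _ fun t => by positivity

/-- `ℤ³`-periodicity. -/
def IsCellPeriodic (u : (Fin 3 → ℝ) → ℂ) : Prop :=
  ∀ (y : Fin 3 → ℝ) (m : Fin 3 → ℤ), u (y + fun i => (m i : ℝ)) = u y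

lemma IsCellPeriodic.update_add_one {u : (Fin 3 → ℝ) → ℂ} (hu : IsCellPeriodic u)
    (y : Fin 3 → ℝ) (j : Fin 3) (t : ℝ) : u (update y j (t + 1)) = u (update y j t) := by
  rw [← hu (update y j t) (Pi.single j 1)]
  congr 1
  ext i
  by_cases h : i = j
  · subst h; simp
  · simp [h]

lemma IsCellPeriodic.shiftedGrad {u : (Fin 3 → ℝ) → ℂ} (hu : IsCellPeriodic u)
    (θ : Fin 3 → ℝ) (j : Fin 3) : IsCellPeriodic (shiftedGrad θ u j) := by
  intro y m
  unfold _root_.shiftedGrad pd3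
  rw [hu y m, ← fderiv_comp_add_right]
  congr 3
  ext x
  exact hu x m

/-- Poincaré-type inequality along a full period in the direction `j`. -/
lemma ofReal_mul_norm_sq_le_lintegral_update {u : (Fin 3 → ℝ) → ℂ} (hu : ContDiff ℝ 1 u)
    (hper : IsCellPeriodic u) (θ : Fin 3 → ℝ) (y : Fin 3 → ℝ) (j : Fin 3) :
    ENNReal.ofReal (‖Complex.exp (Complex.I * (θ j : ℂ)) - 1‖ ^ 2 * ‖u y‖ ^ 2)
      ≤ ∫⁻ t, energyDensity θ u j (update y j t) ∂unitMeasure := by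
  have h := norm_exp_mul_sub_sq_le hu θ y j (a := y j) (b := y j + 1) (by linarith) le_rfl
  have hp : Function.Periodic (fun t => ‖shiftedGrad θ u j (update y j t)‖ ^ 2) 1 := fun t => by
    simp only [(hper.shiftedGrad θ j).update_add_one]
  rw [hper.update_add_one, update_eq_self, hp.intervalIntegral_add_eq (y j) (-(1 : ℝ) / 2),
    show -(1 : ℝ) / 2 + 1 = 1 / 2 by norm_num, ← sub_mul, norm_mul] at h
  rw [unitMeasure, ← ofReal_intervalIntegral_shiftedGrad hu θ y j (by norm_num), ← mul_pow]
  refine ENNReal.ofReal_le_ofReal (le_trans (le_of_eq ?_) h)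
  congr 2
  rw [show Complex.exp (Complex.I * ((θ j * (y j + 1) : ℝ) : ℂ))
      - Complex.exp (Complex.I * ((θ j * y j : ℝ) : ℂ))
      = Complex.exp (Complex.I * ((θ j * y j : ℝ) : ℂ)) * (Complex.exp (Complex.I * (θ j : ℂ)) - 1)
      by rw [mul_sub, ← Complex.exp_add]; push_cast; ring_nf,
    norm_mul, Complex.norm_exp_I_mul_ofReal, one_mul]

/-! ### Geometry of the fibres -/

lemma measurableSet_fiberSet (r : ℝ) : MeasurableSet (fiberSet r) := by
  have : fiberSet r = ⋃ m : Fin 2 → ℤ,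
      {y : Fin 3 → ℝ | (y 0 - (m 0 : ℝ)) ^ 2 + (y 1 - (m 1 : ℝ)) ^ 2 < r ^ 2} := by
    ext y; simp [fiberSet]
  rw [this]
  exact MeasurableSet.iUnion fun m => measurableSet_lt (by fun_prop) (by fun_prop)

lemma mem_fiberSet_iff {r : ℝ} {y : Fin 3 → ℝ} {i j : Fin 3} (hi : i ≠ 2) (hj : j ≠ 2)
    (hij : i ≠ j) :
    y ∈ fiberSet r ↔ ∃ m n : ℤ, (y i - m) ^ 2 + (y j - n) ^ 2 < r ^ 2 := by
  have key : (i = 0 ∧ j = 1) ∨ (i = 1 ∧ j = 0) := by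
    fin_cases i <;> fin_cases j <;> simp_all
  rcases key with ⟨rfl, rfl⟩ | ⟨rfl, rfl⟩
  · exact ⟨fun ⟨m, h⟩ => ⟨m 0, m 1, h⟩, fun ⟨m, n, h⟩ => ⟨![m, n], by simpa using h⟩⟩
  · exact ⟨fun ⟨m, h⟩ => ⟨m 1, m 0, by linarith⟩,
      fun ⟨m, n, h⟩ => ⟨![n, m], by simpa [add_comm] using h⟩⟩

lemma update_two_mem_fiberSet_iff {r : ℝ} {y : Fin 3 → ℝ} {t : ℝ} :
    update y 2 t ∈ fiberSet r ↔ y ∈ fiberSet r := by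
  simp [fiberSet]

lemma one_half_le_abs_sub_intCast {t : ℝ} (ht : |t| ≤ 1 / 2) {n : ℤ} (hn : n ≠ 0) :
    1 / 2 ≤ |t - n| := by
  have h1 : (1 : ℝ) ≤ |(n : ℝ)| := by exact_mod_cast Int.one_le_abs hn
  have h2 := abs_sub_abs_le_abs_sub (n : ℝ) t
  rw [abs_sub_comm] at h2
  linarith

lemma update_notMem_fiberSet {r : ℝ} (hr : 0 < r) (hr' : r < 1 / 2) {y : Fin 3 → ℝ}
    (hy : y ∉ fiberSet r) {j : Fin 3} (hj : j ≠ 2) {t : ℝ} (ht : |y j| ≤ |t|)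
    (ht' : |t| ≤ 1 / 2) : update y j t ∉ fiberSet r := by
  obtain ⟨i, hi, hij⟩ : ∃ i : Fin 3, i ≠ 2 ∧ i ≠ j := by
    fin_cases j
    · exact ⟨1, by decide, by decide⟩
    · exact ⟨0, by decide, by decide⟩
    · exact absurd rfl hj
  rw [mem_fiberSet_iff hi hj hij] at hy ⊢
  rintro ⟨m, n, h⟩
  rw [update_self, update_of_ne hij] at h
  by_cases hn : n = 0
  · subst hn
    refine hy ⟨m, 0, lt_of_le_of_lt ?_ h⟩
    have := sq_le_sq.2 ht
    simpa using this
  · have h1 := one_half_le_abs_sub_intCast ht' hn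
    have h2 := sq_abs (t - n)
    nlinarith [sq_nonneg (y i - m)]

lemma notMem_fiberSet_of_lt_abs {r : ℝ} (hr : 0 < r) (hr' : r < 1 / 2) {y : Fin 3 → ℝ}
    {j : Fin 3} (hj : j ≠ 2) (hy : r < |y j|) (hy' : |y j| ≤ 1 / 2) : y ∉ fiberSet r := by
  obtain ⟨i, hi, hij⟩ : ∃ i : Fin 3, i ≠ 2 ∧ i ≠ j := by
    fin_cases j
    · exact ⟨1, by decide, by decide⟩
    · exact ⟨0, by decide, by decide⟩
    · exact absurd rfl hj
  rw [mem_fiberSet_iff hi hj hij]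
  rintro ⟨m, n, h⟩
  have h2 := sq_abs (y j - n)
  by_cases hn : n = 0
  · subst hn
    simp only [Int.cast_zero, sub_zero] at h h2
    nlinarith [sq_nonneg (y i - m)]
  · have h1 := one_half_le_abs_sub_intCast hy' hn
    nlinarith [sq_nonneg (y i - m)]

/-! ### Estimates in the complement of the fibres -/

/-- The energy density restricted to the complement of the fibres. -/
noncomputable def outerDensity (r : ℝ) (θ : Fin 3 → ℝ) (u : (Fin 3 → ℝ) → ℂ) (j : Fin 3) :
    (Fin 3 → ℝ) → ENNReal :=
  (fiberSet r)ᶜ.indicator (energyDensity θ u j)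

lemma measurable_outerDensity {u : (Fin 3 → ℝ) → ℂ} (hu : ContDiff ℝ 1 u) (r : ℝ)
    (θ : Fin 3 → ℝ) (j : Fin 3) : Measurable (outerDensity r θ u j) :=
  (measurable_energyDensity hu θ j).indicator (measurableSet_fiberSet r).compl

lemma ofReal_norm_exp_mul_sub_sq_le {r : ℝ} {u : (Fin 3 → ℝ) → ℂ} (hu : ContDiff ℝ 1 u)
    (θ : Fin 3 → ℝ) (y : Fin 3 → ℝ) (j : Fin 3) {a b : ℝ} (hab : a ≤ b) (ha : -(1 : ℝ) / 2 ≤ a)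
    (hb : b ≤ 1 / 2) (h : ∀ t ∈ Set.Icc a b, update y j t ∉ fiberSet r) :
    ENNReal.ofReal (‖Complex.exp (Complex.I * ((θ j * b : ℝ) : ℂ)) * u (update y j b)
      - Complex.exp (Complex.I * ((θ j * a : ℝ) : ℂ)) * u (update y j a)‖ ^ 2)
      ≤ ∫⁻ t, outerDensity r θ u j (update y j t) ∂unitMeasure := by
  refine (ENNReal.ofReal_le_ofReal (norm_exp_mul_sub_sq_le hu θ y j hab (by linarith))).trans ?_
  rw [ofReal_intervalIntegral_shiftedGrad hu θ y j hab]
  calc _ = ∫⁻ t in Set.Ico a b, outerDensity r θ u j (update y j t) :=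
        setLIntegral_congr_fun measurableSet_Ico fun t ht =>
          (Set.indicator_of_mem (h t ⟨ht.1, ht.2.le⟩) (energyDensity θ u j)).symm
    _ ≤ _ := lintegral_mono' (Measure.restrict_mono (Set.Ico_subset_Ico ha hb) le_rfl) le_rfl

/-- Comparison of `u` at a point outside the fibres with the energy along the segment which joins
it, in the direction `j`, to a line in the direction `i` that avoids the fibres. -/
lemma ofReal_mul_norm_sq_le_outerDensity {r : ℝ} (hr : 0 < r) (hr' : r < 1 / 2)
    {u : (Fin 3 → ℝ) → ℂ} (hu : ContDiff ℝ 1 u) (hper : IsCellPeriodic u) (θ : Fin 3 → ℝ)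
    {i j : Fin 3} (hj : j ≠ 2) (hij : i ≠ j) {y : Fin 3 → ℝ} (hy : y ∉ fiberSet r)
    (hyj : |y j| ≤ 1 / 2) {s : ℝ} (hs : r < |s|) (hs' : |s| ≤ 1 / 2) (hsy : 0 ≤ s * y j) :
    ENNReal.ofReal (‖Complex.exp (Complex.I * (θ i : ℂ)) - 1‖ ^ 2 * ‖u y‖ ^ 2)
      ≤ 8 * ∫⁻ t, outerDensity r θ u j (update y j t) ∂unitMeasure
        + 2 * ∫⁻ t, outerDensity r θ u i (update (update y j s) i t) ∂unitMeasure := by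
  have hline : ∫⁻ t, outerDensity r θ u i (update (update y j s) i t) ∂unitMeasure
      = ∫⁻ t, energyDensity θ u i (update (update y j s) i t) ∂unitMeasure := by
    refine lintegral_congr fun t => Set.indicator_of_mem (s := (fiberSet r)ᶜ) ?_ _
    refine notMem_fiberSet_of_lt_abs hr hr' hj ?_ ?_ <;>
      rwa [update_of_ne hij.symm, update_self]
  have hB := ofReal_mul_norm_sq_le_lintegral_update hu hper θ (update y j s) i
  rw [← hline] at hB
  have hA : ENNReal.ofReal (‖Complex.exp (Complex.I * ((θ j * s : ℝ) : ℂ)) * u (update y j s)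
      - Complex.exp (Complex.I * ((θ j * y j : ℝ) : ℂ)) * u y‖ ^ 2)
      ≤ ∫⁻ t, outerDensity r θ u j (update y j t) ∂unitMeasure := by
    have hfree : ∀ t, (t ∈ Set.Icc (y j) s ∨ t ∈ Set.Icc s (y j)) →
        update y j t ∉ fiberSet r := by
      intro t ht
      by_cases hlt : |y j| ≤ |t|
      · refine update_notMem_fiberSet hr hr' hy hj hlt ?_
        rw [abs_le] at *
        rcases ht with ht | ht <;> constructor <;> linarith [ht.1, ht.2]
      · have h1 : |s| ≤ |t| := by
          rcases ht with ⟨h1, h2⟩ | ⟨h1, h2⟩ <;>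
          · push Not at hlt
            rcases le_or_gt 0 s with h0 | h0 <;> rcases le_or_gt 0 (y j) with h3 | h3 <;>
            rcases le_or_gt 0 t with h4 | h4 <;>
            simp only [abs_of_nonneg, abs_of_neg, *] at hlt ⊢ <;> first | linarith | nlinarith
        refine notMem_fiberSet_of_lt_abs hr hr' hj ?_ ?_ <;> rw [update_self] <;> linarith
    rw [abs_le] at hyj hs'
    rcases le_total (y j) s with hle | hle
    · have h := ofReal_norm_exp_mul_sub_sq_le (r := r) hu θ y j hle (by linarith) (by linarith)
        fun t ht => hfree t (Or.inl ht)
      rwa [update_eq_self] at h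
    · have h := ofReal_norm_exp_mul_sub_sq_le (r := r) hu θ y j hle (by linarith) (by linarith)
        fun t ht => hfree t (Or.inr ht)
      rwa [update_eq_self, norm_sub_rev] at h
  refine le_trans ?_ (add_le_add (mul_le_mul_right hA 8) (mul_le_mul_right hB 2))
  rw [show (8 : ENNReal) = ENNReal.ofReal 8 by simp, show (2 : ENNReal) = ENNReal.ofReal 2 by simp,
    ← ENNReal.ofReal_mul (by norm_num), ← ENNReal.ofReal_mul (by norm_num),
    ← ENNReal.ofReal_add (by positivity) (by positivity)]
  refine ENNReal.ofReal_le_ofReal ?_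
  have h1 := norm_sub_norm_le (Complex.exp (Complex.I * ((θ j * y j : ℝ) : ℂ)) * u y)
    (Complex.exp (Complex.I * ((θ j * s : ℝ) : ℂ)) * u (update y j s))
  rw [norm_sub_rev, norm_mul, norm_mul, Complex.norm_exp_I_mul_ofReal,
    Complex.norm_exp_I_mul_ofReal, one_mul, one_mul] at h1
  have h2 : ‖Complex.exp (Complex.I * (θ i : ℂ)) - 1‖ ≤ 2 := by
    refine (norm_sub_le _ _).trans ?_
    rw [Complex.norm_exp_I_mul_ofReal, norm_one]; norm_num
  generalize ‖Complex.exp (Complex.I * ((θ j * s : ℝ) : ℂ)) * u (update y j s)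
      - Complex.exp (Complex.I * ((θ j * y j : ℝ) : ℂ)) * u y‖ = A at *
  have h3 := norm_nonneg (Complex.exp (Complex.I * (θ i : ℂ)) - 1)
  generalize ‖Complex.exp (Complex.I * (θ i : ℂ)) - 1‖ = ω at *
  have h4 := norm_nonneg (u y)
  have h5 : ‖u y‖ ^ 2 ≤ 2 * A ^ 2 + 2 * ‖u (update y j s)‖ ^ 2 := by
    nlinarith [sq_nonneg (A - ‖u (update y j s)‖)]
  have h6 : ω ^ 2 ≤ 4 := by nlinarith
  nlinarith [mul_le_mul_of_nonneg_left h5 (sq_nonneg ω),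
    mul_le_mul_of_nonneg_right h6 (sq_nonneg A)]

/-- Integrated form of `ofReal_mul_norm_sq_le_outerDensity`. -/
lemma lintegral_compl_fiberSet_le {r : ℝ} (hr : 0 < r) (hr' : r < 1 / 2)
    {u : (Fin 3 → ℝ) → ℂ} (hu : ContDiff ℝ 1 u) (hper : IsCellPeriodic u) (θ : Fin 3 → ℝ)
    {i j : Fin 3} (hj : j ≠ 2) (hij : i ≠ j) :
    ENNReal.ofReal (1 / 2 - r) * ∫⁻ y in cell \ fiberSet r,
        ENNReal.ofReal (‖Complex.exp (Complex.I * (θ i : ℂ)) - 1‖ ^ 2 * ‖u y‖ ^ 2)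
      ≤ 8 * (∫⁻ y in cell \ fiberSet r, energyDensity θ u j y)
        + 2 * ∫⁻ y in cell \ fiberSet r, energyDensity θ u i y := by
  set X : (Fin 3 → ℝ) → ENNReal := fun y =>
    ENNReal.ofReal (‖Complex.exp (Complex.I * (θ i : ℂ)) - 1‖ ^ 2 * ‖u y‖ ^ 2) with hX
  have hXm : Measurable X := by
    have := hu.continuous
    exact ENNReal.measurable_ofReal.comp (Continuous.measurable (by fun_prop))
  have hG := measurable_outerDensity hu r θ
  have hPi : Measurable fun y => ∫⁻ t, outerDensity r θ u i (update y i t) ∂unitMeasure :=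
    ((hG i).comp measurable_update').lintegral_prod_right'
  have hcompl (f : (Fin 3 → ℝ) → ENNReal) :
      ∫⁻ y in cell \ fiberSet r, f y = ∫⁻ y in cell, (fiberSet r)ᶜ.indicator f y := by
    rw [lintegral_indicator (measurableSet_fiberSet r).compl,
      Measure.restrict_restrict (measurableSet_fiberSet r).compl, Set.inter_comm, Set.sdiff_eq]
  have hpt : ∀ y ∈ cell, ENNReal.ofReal (1 / 2 - r) * (fiberSet r)ᶜ.indicator X y
      ≤ 8 * (∫⁻ t, outerDensity r θ u j (update y j t) ∂unitMeasure)
        + 2 * ∫⁻ s, (∫⁻ t, outerDensity r θ u i (update (update y j s) i t) ∂unitMeasure)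
          ∂unitMeasure := by
    intro y hyc
    by_cases hy : y ∈ fiberSet r
    · simp [hy]
    rw [Set.indicator_of_mem (s := (fiberSet r)ᶜ) hy]
    have hyj := hyc j (Set.mem_univ j)
    obtain ⟨S, hSm, hSI, hSv, hS⟩ : ∃ S : Set ℝ, MeasurableSet S ∧
        S ⊆ Set.Ico (-(1 : ℝ) / 2) (1 / 2) ∧ volume S = ENNReal.ofReal (1 / 2 - r) ∧
        ∀ s ∈ S, r < |s| ∧ |s| ≤ 1 / 2 ∧ 0 ≤ s * y j := by
      rcases le_or_gt 0 (y j) with h0 | h0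
      · refine ⟨Set.Ioo r (1 / 2), measurableSet_Ioo, fun s hs => ⟨by linarith [hs.1], hs.2⟩,
          by rw [Real.volume_Ioo], fun s hs => ?_⟩
        have : 0 < s := hr.trans hs.1
        rw [abs_of_pos this]
        exact ⟨hs.1, hs.2.le, by positivity⟩
      · refine ⟨Set.Ioo (-(1 : ℝ) / 2) (-r), measurableSet_Ioo,
          fun s hs => ⟨hs.1.le, by linarith [hs.2]⟩,
          by rw [Real.volume_Ioo]; congr 1; ring, fun s hs => ?_⟩
        have : s < 0 := by linarith [hs.2]
        rw [abs_of_neg this]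
        exact ⟨by linarith [hs.2], by linarith [hs.1], (mul_pos_of_neg_of_neg this h0).le⟩
    set A := ∫⁻ t, outerDensity r θ u j (update y j t) ∂unitMeasure
    have hB : Measurable fun s =>
        ∫⁻ t, outerDensity r θ u i (update (update y j s) i t) ∂unitMeasure :=
      hPi.comp (measurable_update y)
    calc ENNReal.ofReal (1 / 2 - r) * X y = ∫⁻ _ in S, X y := by
          rw [setLIntegral_const, hSv, mul_comm]
      _ ≤ ∫⁻ s in S, (8 * A
            + 2 * ∫⁻ t, outerDensity r θ u i (update (update y j s) i t) ∂unitMeasure) :=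
          setLIntegral_mono' hSm fun s hs =>
            ofReal_mul_norm_sq_le_outerDensity hr hr' hu hper θ hj hij hy
              (abs_le.2 ⟨by linarith [hyj.1], hyj.2.le⟩) (hS s hs).1 (hS s hs).2.1 (hS s hs).2.2
      _ ≤ ∫⁻ s, (8 * A
            + 2 * ∫⁻ t, outerDensity r θ u i (update (update y j s) i t) ∂unitMeasure)
            ∂unitMeasure := lintegral_mono' (Measure.restrict_mono hSI le_rfl) le_rfl
      _ = _ := by
          rw [lintegral_add_left measurable_const, lintegral_const, measure_univ, mul_one,
            lintegral_const_mul _ hB]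
  rw [hcompl, hcompl, hcompl]
  have hPj : Measurable fun y => ∫⁻ t, outerDensity r θ u j (update y j t) ∂unitMeasure :=
    ((hG j).comp measurable_update').lintegral_prod_right'
  have hPji : Measurable fun y => ∫⁻ s, (∫⁻ t, outerDensity r θ u i (update (update y j s) i t)
      ∂unitMeasure) ∂unitMeasure :=
    (hPi.comp measurable_update').lintegral_prod_right'
  calc _ = ∫⁻ y in cell, ENNReal.ofReal (1 / 2 - r) * (fiberSet r)ᶜ.indicator X y := by
        rw [lintegral_const_mul _ (hXm.indicator (measurableSet_fiberSet r).compl)]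
    _ ≤ _ := setLIntegral_mono' measurableSet_cell hpt
    _ = _ := by
        rw [lintegral_add_left (hPj.const_mul 8), lintegral_const_mul _ hPj,
          lintegral_const_mul _ hPji, lintegral_cell_lintegral_update j (hG j),
          lintegral_cell_lintegral_update j hPi, lintegral_cell_lintegral_update i (hG i)]
        rfl

/-- Poincaré-type inequality in the fibre direction on a set invariant in that direction. -/
lemma lintegral_inter_le {u : (Fin 3 → ℝ) → ℂ} (hu : ContDiff ℝ 1 u)
    (hper : IsCellPeriodic u) (θ : Fin 3 → ℝ) {j : Fin 3} {S : Set (Fin 3 → ℝ)}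
    (hSm : MeasurableSet S) (hS : ∀ y t, update y j t ∈ S ↔ y ∈ S) :
    ∫⁻ y in cell ∩ S,
        ENNReal.ofReal (‖Complex.exp (Complex.I * (θ j : ℂ)) - 1‖ ^ 2 * ‖u y‖ ^ 2)
      ≤ ∫⁻ y in cell ∩ S, energyDensity θ u j y := by
  have hinter (f : (Fin 3 → ℝ) → ENNReal) :
      ∫⁻ y in cell ∩ S, f y = ∫⁻ y in cell, S.indicator f y := by
    rw [lintegral_indicator hSm, Measure.restrict_restrict hSm, Set.inter_comm]
  rw [hinter, hinter, ← lintegral_cell_lintegral_update j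
    ((measurable_energyDensity hu θ j).indicator hSm)]
  refine lintegral_mono fun y => ?_
  by_cases hy : y ∈ S
  · simp only [Set.indicator, hS, hy, if_true]
    exact ofReal_mul_norm_sq_le_lintegral_update hu hper θ y j
  · simp [Set.indicator, hS, hy]

/-! ### Passage to Bochner integrals -/

lemma integrableOn_cell_of_continuous {E : Type*} [NormedAddCommGroup E] {f : (Fin 3 → ℝ) → E}
    (hf : Continuous f) : IntegrableOn f cell := by
  refine (hf.integrableOn_Icc (a := fun _ => -(1 : ℝ) / 2) (b := fun _ => 1 / 2)).mono_set ?_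
  exact fun y hy => ⟨fun i => (hy i (Set.mem_univ i)).1, fun i => (hy i (Set.mem_univ i)).2.le⟩

lemma ofReal_setIntegral_of_continuous {f : (Fin 3 → ℝ) → ℝ} (hf : Continuous f)
    (hf0 : ∀ y, 0 ≤ f y) {S : Set (Fin 3 → ℝ)} (hS : S ⊆ cell) :
    ENNReal.ofReal (∫ y in S, f y) = ∫⁻ y in S, ENNReal.ofReal (f y) :=
  ofReal_integral_eq_lintegral_ofReal ((integrableOn_cell_of_continuous hf).mono_set hS)
    (ae_of_all _ hf0)

lemma sq_mul_integral_le_sq_norm_exp_sub_one {x : ℝ} (hx : |x| ≤ π) {I : ℝ} (hI : 0 ≤ I) :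
    (2 / π) ^ 2 * (x ^ 2 * I) ≤ ‖Complex.exp (Complex.I * x) - 1‖ ^ 2 * I := by
  rw [← mul_assoc, ← sq_abs x, ← mul_pow]
  gcongr
  exact two_div_pi_mul_abs_le_norm_exp_sub_one hx

lemma setIntegral_compl_fiberSet_le {r : ℝ} (hr : 0 < r) (hr' : r < 1 / 2)
    {u : (Fin 3 → ℝ) → ℂ} (hu : ContDiff ℝ 1 u) (hper : IsCellPeriodic u) {θ : Fin 3 → ℝ}
    {i j : Fin 3} (hθ : |θ i| ≤ π) (hj : j ≠ 2) (hij : i ≠ j) :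
    (1 / 2 - r) * ((2 / π) ^ 2 * (θ i ^ 2 * ∫ y in cell \ fiberSet r, ‖u y‖ ^ 2))
      ≤ 8 * (∫ y in cell \ fiberSet r, ‖shiftedGrad θ u j y‖ ^ 2)
        + 2 * ∫ y in cell \ fiberSet r, ‖shiftedGrad θ u i y‖ ^ 2 := by
  have hI : 0 ≤ ∫ y in cell \ fiberSet r, ‖u y‖ ^ 2 := integral_nonneg fun y => by positivity
  have hk (k : Fin 3) : 0 ≤ ∫ y in cell \ fiberSet r, ‖shiftedGrad θ u k y‖ ^ 2 :=
    integral_nonneg fun y => by positivity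
  have hc (k : Fin 3) := continuous_shiftedGrad hu θ k
  have hc' := hu.continuous
  have h := lintegral_compl_fiberSet_le hr hr' hu hper θ hj hij
  simp only [energyDensity] at h
  rw [← ofReal_setIntegral_of_continuous (by fun_prop) (fun y => by positivity) Set.sdiff_subset,
    ← ofReal_setIntegral_of_continuous (by fun_prop) (fun y => by positivity) Set.sdiff_subset,
    ← ofReal_setIntegral_of_continuous (by fun_prop) (fun y => by positivity) Set.sdiff_subset,
    show (8 : ENNReal) = ENNReal.ofReal 8 by simp, show (2 : ENNReal) = ENNReal.ofReal 2 by simp,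
    ← ENNReal.ofReal_mul (by linarith), ← ENNReal.ofReal_mul (by norm_num),
    ← ENNReal.ofReal_mul (by norm_num),
    ← ENNReal.ofReal_add (mul_nonneg (by norm_num) (hk j)) (mul_nonneg (by norm_num) (hk i)),
    ENNReal.ofReal_le_ofReal_iff (by linarith [hk i, hk j]), integral_const_mul] at h
  refine le_trans (mul_le_mul_of_nonneg_left ?_ (by linarith)) h
  exact sq_mul_integral_le_sq_norm_exp_sub_one hθ hI

lemma setIntegral_inter_le {u : (Fin 3 → ℝ) → ℂ} (hu : ContDiff ℝ 1 u)
    (hper : IsCellPeriodic u) {θ : Fin 3 → ℝ} {j : Fin 3} (hθ : |θ j| ≤ π)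
    {S : Set (Fin 3 → ℝ)} (hSm : MeasurableSet S) (hS : ∀ y t, update y j t ∈ S ↔ y ∈ S) :
    (2 / π) ^ 2 * (θ j ^ 2 * ∫ y in cell ∩ S, ‖u y‖ ^ 2)
      ≤ ∫ y in cell ∩ S, ‖shiftedGrad θ u j y‖ ^ 2 := by
  have hI : 0 ≤ ∫ y in cell ∩ S, ‖u y‖ ^ 2 := integral_nonneg fun y => by positivity
  have hc := continuous_shiftedGrad hu θ j
  have hc' := hu.continuous
  have h := lintegral_inter_le hu hper θ hSm hS
  simp only [energyDensity] at h
  rw [← ofReal_setIntegral_of_continuous (by fun_prop) (fun y => by positivity)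
      Set.inter_subset_left,
    ← ofReal_setIntegral_of_continuous (by fun_prop) (fun y => by positivity)
      Set.inter_subset_left,
    ENNReal.ofReal_le_ofReal_iff (integral_nonneg fun y => by positivity),
    integral_const_mul] at h
  exact (sq_mul_integral_le_sq_norm_exp_sub_one hθ hI).trans h

/-- The form controls the energies inside and outside the fibres. -/
lemma le_aForm {r ν : ℝ} {a : ℝ → ℝ} (ha_meas : Measurable a) (hν : 0 < ν)
    (ha_lb : ∀ s, ν < a s) (ha_ub : ∀ s, a s < ν⁻¹) (θ : Fin 3 → ℝ) {u : (Fin 3 → ℝ) → ℂ}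
    (hu : ContDiff ℝ 1 u) :
    ν * (∫ y in cell ∩ fiberSet r, ‖shiftedGrad θ u 2 y‖ ^ 2)
      + ∑ j, ∫ y in cell \ fiberSet r, ‖shiftedGrad θ u j y‖ ^ 2 ≤ aForm a r θ u := by
  have hc (k : Fin 3) := continuous_shiftedGrad hu θ k
  have hint (k : Fin 3) : IntegrableOn (fun y => ‖shiftedGrad θ u k y‖ ^ 2) cell :=
    integrableOn_cell_of_continuous (by fun_prop)
  have hint' : IntegrableOn (fun y => a (y 2) * ‖shiftedGrad θ u 2 y‖ ^ 2) cell := by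
    refine (hint 2).bdd_mul (c := ν⁻¹)
      (ha_meas.comp (measurable_pi_apply 2)).aestronglyMeasurable (ae_of_all _ fun y => ?_)
    rw [Real.norm_of_nonneg (hν.trans (ha_lb _)).le]
    exact (ha_ub _).le
  have hsum : IntegrableOn (fun y => ∑ j, ‖shiftedGrad θ u j y‖ ^ 2) cell :=
    integrable_finsetSum _ fun j _ => hint j
  have hF := measurableSet_fiberSet r
  have hform : aForm a r θ u = (∫ y in cell ∩ fiberSet r, a (y 2) * ‖shiftedGrad θ u 2 y‖ ^ 2)
      + ∫ y in cell \ fiberSet r, ∑ j, ‖shiftedGrad θ u j y‖ ^ 2 := by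
    have hpw : (fun y => if y ∈ fiberSet r then a (y 2) * ‖shiftedGrad θ u 2 y‖ ^ 2
        else ∑ j, ‖shiftedGrad θ u j y‖ ^ 2)
        = (fiberSet r).piecewise (fun y => a (y 2) * ‖shiftedGrad θ u 2 y‖ ^ 2)
          (fun y => ∑ j, ‖shiftedGrad θ u j y‖ ^ 2) := rfl
    change (∫ y in cell, if y ∈ fiberSet r then a (y 2) * ‖shiftedGrad θ u 2 y‖ ^ 2
        else ∑ j, ‖shiftedGrad θ u j y‖ ^ 2) = _
    rw [hpw, integral_piecewise hF hint'.integrableOn hsum.integrableOn,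
      Measure.restrict_restrict hF, Measure.restrict_restrict hF.compl, Set.inter_comm,
      Set.inter_comm _ cell, Set.sdiff_eq]
  rw [hform, integral_finsetSum _ fun j _ => (hint j).mono_set Set.sdiff_subset]
  gcongr
  rw [← integral_const_mul]
  refine integral_mono (((hint 2).mono_set Set.inter_subset_left).const_mul ν)
    (hint'.mono_set Set.inter_subset_left) fun y => ?_
  exact mul_le_mul_of_nonneg_right (ha_lb _).le (by positivity)

/-- Directionally-dependent quadratic lower bound: there is `γ* > 0` such that
`a_θ[u] ≥ γ* (|θ₃|² ∫_{□∩F} |u|² + |θ|² ∫_{□∖F} |u|²)` for all `θ ∈ □*` and all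
`C¹` periodic `u`. -/
theorem directional_quadratic_lower_bound
    (r ν : ℝ) (hr : 0 < r) (hr' : r < 1 / 2) (hν : 0 < ν)
    (a : ℝ → ℝ) (ha_meas : Measurable a) (ha_per : ∀ s, a (s + 1) = a s)
    (ha_lb : ∀ s, ν < a s) (ha_ub : ∀ s, a s < ν⁻¹) :
    ∃ γstar > (0 : ℝ),
      ∀ θ ∈ dualCell,
      ∀ u : (Fin 3 → ℝ) → ℂ, ContDiff ℝ 1 u →
        (∀ (y : Fin 3 → ℝ) (m : Fin 3 → ℤ), u (y + fun i => (m i : ℝ)) = u y) →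
        γstar * ((θ 2) ^ 2 * (∫ y in cell ∩ fiberSet r, ‖u y‖ ^ 2) +
            (∑ j, (θ j) ^ 2) * (∫ y in cell \ fiberSet r, ‖u y‖ ^ 2)) ≤
          aForm a r θ u := by
  have hℓ : 0 < 1 / 2 - r := by linarith
  set K : ℝ := 10 / (1 / 2 - r) with hK
  have hK1 : 1 ≤ K := by rw [hK, le_div_iff₀ hℓ]; linarith
  have hK0 : 0 < K := one_pos.trans_le hK1
  set c : ℝ := (2 / π) ^ 2 with hc
  have hc0 : 0 < c := by positivity
  set κ : ℝ := min ν 1 with hκ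
  have hκ0 : 0 < κ := lt_min hν one_pos
  refine ⟨κ * c / (3 * K), by positivity, fun θ hθ u hu hper => ?_⟩
  have hθπ (j : Fin 3) : |θ j| ≤ π :=
    abs_le.2 ⟨(hθ j (Set.mem_univ j)).1, (hθ j (Set.mem_univ j)).2.le⟩
  have hF := measurableSet_fiberSet r
  have hform := le_aForm (r := r) ha_meas hν ha_lb ha_ub θ hu
  have h2F := setIntegral_inter_le hu hper (hθπ 2) hF fun y t => update_two_mem_fiberSet_iff
  have h2 := setIntegral_inter_le hu hper (hθπ 2) hF.compl
    fun y t => not_congr update_two_mem_fiberSet_iff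
  rw [← Set.sdiff_eq] at h2
  have h0 := setIntegral_compl_fiberSet_le hr hr' hu hper (hθπ 0) (j := 1) (by decide) (by decide)
  have h1 := setIntegral_compl_fiberSet_le hr hr' hu hper (hθπ 1) (j := 0) (by decide) (by decide)
  have hD (k : Fin 3) : 0 ≤ ∫ y in cell \ fiberSet r, ‖shiftedGrad θ u k y‖ ^ 2 :=
    integral_nonneg fun y => by positivity
  have hDF : 0 ≤ ∫ y in cell ∩ fiberSet r, ‖shiftedGrad θ u 2 y‖ ^ 2 :=
    integral_nonneg fun y => by positivity
  have hD0 := hD 0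
  have hD1 := hD 1
  have hD2 := hD 2
  rw [Fin.sum_univ_three] at hform ⊢
  generalize aForm a r θ u = Q at *
  generalize (∫ y in cell ∩ fiberSet r, ‖shiftedGrad θ u 2 y‖ ^ 2) = DF at *
  generalize (∫ y in cell \ fiberSet r, ‖shiftedGrad θ u 0 y‖ ^ 2) = D0 at *
  generalize (∫ y in cell \ fiberSet r, ‖shiftedGrad θ u 1 y‖ ^ 2) = D1 at *
  generalize (∫ y in cell \ fiberSet r, ‖shiftedGrad θ u 2 y‖ ^ 2) = D2 at *
  generalize (∫ y in cell ∩ fiberSet r, ‖u y‖ ^ 2) = UF at *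
  generalize (∫ y in cell \ fiberSet r, ‖u y‖ ^ 2) = U at *
  have hbound {x D D' : ℝ} (hx : (1 / 2 - r) * x ≤ 8 * D' + 2 * D) (hD : 0 ≤ D) (hD' : 0 ≤ D') :
      x ≤ K * (D + D') := by
    rw [hK, div_mul_eq_mul_div, le_div_iff₀ hℓ]
    linarith
  have h0' := hbound h0 hD0 hD1
  have h1' := hbound h1 hD1 hD0
  have htotal : c * (θ 2 ^ 2 * UF + (θ 0 ^ 2 + θ 1 ^ 2 + θ 2 ^ 2) * U)
      ≤ 3 * K * (DF + (D0 + D1 + D2)) := by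
    nlinarith [mul_le_mul_of_nonneg_right hK1 hDF, mul_le_mul_of_nonneg_right hK1 hD2,
      mul_nonneg hK0.le hD0, mul_nonneg hK0.le hD1, mul_nonneg hK0.le hD2,
      mul_nonneg hK0.le hDF]
  have hfinal : κ * (DF + (D0 + D1 + D2)) ≤ Q := by
    refine le_trans ?_ hform
    have e1 := mul_le_mul_of_nonneg_right (min_le_left ν 1) hDF
    have e2 := mul_le_mul_of_nonneg_right (min_le_right ν 1)
      (add_nonneg (add_nonneg hD0 hD1) hD2)
    linarith
  refine le_trans ?_ hfinal
  rw [div_mul_eq_mul_div, div_le_iff₀ (by positivity), mul_assoc]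
  calc _ ≤ κ * (3 * K * (DF + (D0 + D1 + D2))) := mul_le_mul_of_nonneg_left htotal hκ0.le
    _ = _ := by ring
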